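/- arXiv:1408.2247 — 2 statements merged into one kernel-verified Lean document; each statement's English description precedes it below -/
import Mathlib

section
/- Let n be odd and let p₁, …, pₙ be points all lying on one line ℓ in E, none lying on the circle C. Then the composition I_{pₙ} ∘ ⋯ ∘ I_{p₁} : C → C is not the identity map of C; in particular, the chain of chords through p₁, …, pₙ cannot close for every starting point. -/
open Metric

/-- The Euclidean plane. -/
abbrev E2 : Type := EuclideanSpace ℝ (Fin 2)

/-- `I` restricts on the circle `sphere o ρ` to the chord map through `p`:
for every `x` on the circle, `I x` is the point of the circle on the line through `x` and `p`
such that every point of the circle on that line equals `x` or `I x`. -/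
def ChordMap (o : E2) (ρ : ℝ) (p : E2) (I : E2 → E2) : Prop :=
  ∀ x ∈ sphere o ρ, I x ∈ sphere o ρ ∧
    I x ∈ affineSpan ℝ ({x, p} : Set E2) ∧
    ∀ z ∈ sphere o ρ, z ∈ affineSpan ℝ ({x, p} : Set E2) → z = x ∨ z = I x

/-- Apply a list of maps in order: `chain [f₁, …, fₙ] x = fₙ (⋯ (f₁ x) ⋯)`,
i.e. the composition `fₙ ∘ ⋯ ∘ f₁` applied to `x`. -/
def chain (I : List (E2 → E2)) (x : E2) : E2 :=
  I.foldl (fun y f => f y) x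

open Matrix

/-- Homogeneous coordinates of `x` relative to the circle `sphere o ρ`, which becomes the cone
`X₀ ^ 2 + X₁ ^ 2 = X₂ ^ 2`. -/
def homogeneousLift (o : E2) (ρ : ℝ) (x : E2) : Fin 3 → ℝ :=
  ![x 0 - o 0, x 1 - o 1, ρ]

/-- The power of the point `p` with respect to the circle `sphere o ρ`. -/
def circlePower (o : E2) (ρ : ℝ) (p : E2) : ℝ :=
  (p 0 - o 0) ^ 2 + (p 1 - o 1) ^ 2 - ρ ^ 2

/-- The reflection in the polar of `p` for the Lorentzian form `X₀ ^ 2 + X₁ ^ 2 - X₂ ^ 2`,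
multiplied by the power of `p`. -/
def chordMatrix (o : E2) (ρ : ℝ) (p : E2) : Matrix (Fin 3) (Fin 3) ℝ :=
  !![circlePower o ρ p - 2 * (p 0 - o 0) ^ 2, -2 * (p 0 - o 0) * (p 1 - o 1),
      2 * (p 0 - o 0) * ρ;
    -2 * (p 0 - o 0) * (p 1 - o 1), circlePower o ρ p - 2 * (p 1 - o 1) ^ 2,
      2 * (p 1 - o 1) * ρ;
    -2 * (p 0 - o 0) * ρ, -2 * (p 1 - o 1) * ρ, circlePower o ρ p + 2 * ρ ^ 2]

theorem mem_sphere_iff_coords {o : E2} {ρ : ℝ} (hρ : 0 < ρ) {x : E2} :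
    x ∈ sphere o ρ ↔ (x 0 - o 0) ^ 2 + (x 1 - o 1) ^ 2 = ρ ^ 2 := by
  rw [mem_sphere, EuclideanSpace.dist_eq, Real.sqrt_eq_iff_eq_sq (by positivity) hρ.le]
  simp [Fin.sum_univ_two, Real.dist_eq, sq_abs]

theorem circlePower_ne_zero {o : E2} {ρ : ℝ} (hρ : 0 < ρ) {p : E2} (hp : p ∉ sphere o ρ) :
    circlePower o ρ p ≠ 0 := by
  rw [mem_sphere_iff_coords hρ] at hp
  exact sub_ne_zero.mpr hp

theorem det_chordMatrix (o : E2) (ρ : ℝ) (p : E2) :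
    (chordMatrix o ρ p).det = -circlePower o ρ p ^ 3 := by
  simp only [chordMatrix, det_fin_three, of_apply, cons_val', cons_val_zero, cons_val_one,
    cons_val, cons_val_fin_one, circlePower]
  ring

theorem chordMatrix_mulVec_of_orthogonal {o : E2} {ρ : ℝ} {p : E2} {v : Fin 3 → ℝ}
    (hv : (p 0 - o 0) * v 0 + (p 1 - o 1) * v 1 - ρ * v 2 = 0) :
    chordMatrix o ρ p *ᵥ v = circlePower o ρ p • v := by
  ext i
  fin_cases i <;> simp [chordMatrix, mulVec, dotProduct, Fin.sum_univ_three]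
  · linear_combination (-2 * (p 0 - o 0)) * hv
  · linear_combination (-2 * (p 1 - o 1)) * hv
  · linear_combination (-2 * ρ) * hv

theorem exists_coords_of_mem_affineSpan_pair {x y z : E2}
    (hz : z ∈ affineSpan ℝ ({x, y} : Set E2)) :
    ∃ t : ℝ, ∀ i, z i = x i + t * (y i - x i) := by
  obtain ⟨t, rfl⟩ := mem_affineSpan_pair_iff_exists_lineMap_eq.mp hz
  exact ⟨t, fun i => by simp [AffineMap.lineMap_apply]; ring⟩

theorem ChordMap.exists_mulVec_eq {o : E2} {ρ : ℝ} (hρ : 0 < ρ) {p : E2} (hp : p ∉ sphere o ρ)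
    {I : E2 → E2} (hI : ChordMap o ρ p I) {x : E2} (hx : x ∈ sphere o ρ) :
    ∃ c : ℝ, chordMatrix o ρ p *ᵥ homogeneousLift o ρ x = c • homogeneousLift o ρ (I x) := by
  obtain ⟨hy, hyl, huniq⟩ := hI x hx
  have hxs := (mem_sphere_iff_coords hρ).mp hx
  set d := (p 0 - x 0) ^ 2 + (p 1 - x 1) ^ 2 with hd
  set b := (x 0 - o 0) * (p 0 - o 0) + (x 1 - o 1) * (p 1 - o 1) - ρ ^ 2 with hb
  have hd0 : d ≠ 0 := by
    intro h
    apply hp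
    have h0 : p 0 = x 0 := by nlinarith [sq_nonneg (p 0 - x 0), sq_nonneg (p 1 - x 1)]
    have h1 : p 1 = x 1 := by nlinarith [sq_nonneg (p 0 - x 0), sq_nonneg (p 1 - x 1)]
    rwa [mem_sphere_iff_coords hρ, h0, h1]
  obtain ⟨t, ht⟩ : ∃ t : ℝ, (∀ i, I x i = x i + t * (p i - x i)) ∧ t * d = -2 * b := by
    obtain ⟨t, ht⟩ := exists_coords_of_mem_affineSpan_pair hyl
    have hroot : t * (t * d + 2 * b) = 0 := by
      have := (mem_sphere_iff_coords hρ).mp hy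
      rw [ht 0, ht 1] at this
      rw [hd, hb]
      linear_combination this - (1 - 2 * t) * hxs
    rcases mul_eq_zero.mp hroot with h | h
    · have hIx : I x = x := by ext i; simp [ht i, h]
      set z : E2 := AffineMap.lineMap x p (-2 * b / d) with hz
      have hzi : ∀ i, z i = x i + (-2 * b / d) * (p i - x i) := fun i => by
        simp [hz, AffineMap.lineMap_apply]; ring
      have hs : (-2 * b / d) * d = -2 * b := div_mul_cancel₀ _ hd0
      have hzs : z ∈ sphere o ρ := by
        rw [mem_sphere_iff_coords hρ, hzi 0, hzi 1]
        generalize -2 * b / d = s at hs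
        rw [hd, hb] at hs
        linear_combination s * hs + (1 - 2 * s) * hxs
      have hzx : z = I x := by
        rcases huniq z hzs (AffineMap.lineMap_mem_affineSpan_pair _ _ _) with h | h
        · rw [h, hIx]
        · exact h
      exact ⟨_, fun i => by rw [← hzx, hzi], hs⟩
    · exact ⟨t, ht, by linear_combination h⟩
  obtain ⟨hti, htd⟩ := ht
  refine ⟨d, ?_⟩
  ext i
  fin_cases i <;>
    simp [chordMatrix, homogeneousLift, mulVec, dotProduct, Fin.sum_univ_three, hti, circlePower]
  · linear_combination (-(p 0 - x 0)) * htd - (x 0 - o 0) * hxs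
  · linear_combination (-(p 1 - x 1)) * htd - (x 1 - o 1) * hxs
  · linear_combination (-ρ) * hxs

/-- A composition of `n` chord maps is induced by a matrix of determinant `(-1) ^ n * κ ^ 3` which
scales by `κ` every vector orthogonal to all the centres. -/
theorem exists_matrix_chain {o : E2} {ρ : ℝ} (hρ : 0 < ρ) {v : Fin 3 → ℝ} (n : ℕ)
    (p : Fin n → E2) (hp : ∀ i, p i ∉ sphere o ρ)
    (hv : ∀ i, (p i 0 - o 0) * v 0 + (p i 1 - o 1) * v 1 - ρ * v 2 = 0)
    (I : Fin n → E2 → E2) (hI : ∀ i, ChordMap o ρ (p i) (I i)) :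
    ∃ (M : Matrix (Fin 3) (Fin 3) ℝ) (κ : ℝ), κ ≠ 0 ∧ M *ᵥ v = κ • v ∧
      M.det = (-1) ^ n * κ ^ 3 ∧ ∀ x ∈ sphere o ρ, ∃ c : ℝ,
        M *ᵥ homogeneousLift o ρ x = c • homogeneousLift o ρ (chain (List.ofFn I) x) := by
  induction n with
  | zero => exact ⟨1, 1, one_ne_zero, by simp, by simp, fun x _ => ⟨1, by simp [chain]⟩⟩
  | succ n ih =>
    obtain ⟨M, κ, hκ, hMv, hdet, hM⟩ := ih (fun i => p i.succ) (fun i => hp _) (fun i => hv _)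
      (fun i => I i.succ) (fun i => hI _)
    refine ⟨M * chordMatrix o ρ (p 0), circlePower o ρ (p 0) * κ,
      mul_ne_zero (circlePower_ne_zero hρ (hp 0)) hκ, ?_, ?_, fun x hx => ?_⟩
    · rw [← mulVec_mulVec, chordMatrix_mulVec_of_orthogonal (hv 0), mulVec_smul, hMv, smul_smul]
    · rw [det_mul, hdet, det_chordMatrix]
      ring
    · obtain ⟨c, hc⟩ := (hI 0).exists_mulVec_eq hρ (hp 0) hx
      obtain ⟨c', hc'⟩ := hM (I 0 x) (hI 0 x hx).1
      refine ⟨c * c', ?_⟩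
      rw [← mulVec_mulVec, hc, mulVec_smul, hc', smul_smul, List.ofFn_succ]
      simp [chain]

/-- A matrix for which every point of the circle is an eigendirection is scalar. -/
theorem exists_eq_smul_one_of_circle_eigen {o : E2} {ρ : ℝ} (hρ : 0 < ρ)
    {M : Matrix (Fin 3) (Fin 3) ℝ}
    (hM : ∀ x ∈ sphere o ρ, ∃ c : ℝ, M *ᵥ homogeneousLift o ρ x = c • homogeneousLift o ρ x) :
    ∃ c : ℝ, M = c • (1 : Matrix (Fin 3) (Fin 3) ℝ) := by
  have key : ∀ a b : ℝ, a ^ 2 + b ^ 2 = 1 → ∃ c : ℝ, ∀ i,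
      M i 0 * a + M i 1 * b + M i 2 = c * ![a, b, 1] i := by
    intro a b hab
    obtain ⟨c, hc⟩ := hM !₂[o 0 + ρ * a, o 1 + ρ * b] (by
      rw [mem_sphere_iff_coords hρ]
      simp
      linear_combination ρ ^ 2 * hab)
    refine ⟨c, fun i => ?_⟩
    have := congrFun hc i
    simp only [homogeneousLift, mulVec, dotProduct, Fin.sum_univ_three] at this
    fin_cases i <;> simp at this ⊢ <;> apply mul_left_cancel₀ hρ.ne' <;>
      linear_combination this
  obtain ⟨c₁, h₁⟩ := key 1 0 (by norm_num)
  obtain ⟨c₂, h₂⟩ := key (-1) 0 (by norm_num)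
  obtain ⟨c₃, h₃⟩ := key 0 1 (by norm_num)
  obtain ⟨c₄, h₄⟩ := key 0 (-1) (by norm_num)
  simp [Fin.forall_fin_succ] at h₁ h₂ h₃ h₄
  refine ⟨c₁, ?_⟩
  ext i j
  fin_cases i <;> fin_cases j <;> simp <;> linarith

/-- For an odd number of collinear points `p₁, …, pₙ` (none on the circle), the composition
`I_{pₙ} ∘ ⋯ ∘ I_{p₁}` is not the identity map of the circle. -/
theorem castillon_odd_collinear_not_identity
    (o : E2) (ρ : ℝ) (hρ : 0 < ρ)
    (n : ℕ) (hn : Odd n)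
    -- the line ℓ
    (w₁ w₂ : E2) (hw : w₁ ≠ w₂)
    (p : Fin n → E2)
    (hpl : ∀ i, p i ∈ affineSpan ℝ ({w₁, w₂} : Set E2))
    (hpC : ∀ i, p i ∉ sphere o ρ)
    (I : Fin n → E2 → E2) (hI : ∀ i, ChordMap o ρ (p i) (I i)) :
    ¬ (∀ y ∈ sphere o ρ, chain (List.ofFn I) y = y) := by
  intro hid
  set v : Fin 3 → ℝ := ![ρ * (w₂ 1 - w₁ 1), ρ * (w₁ 0 - w₂ 0),
    (w₁ 0 - o 0) * (w₂ 1 - o 1) - (w₁ 1 - o 1) * (w₂ 0 - o 0)] with hvdef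
  have hv : v ≠ 0 := by
    intro h
    apply hw
    have h0 := congrFun h 0
    have h1 := congrFun h 1
    simp [hvdef, hρ.ne'] at h0 h1
    ext i
    fin_cases i <;> simp <;> linarith
  obtain ⟨M, κ, hκ, hMv, hdet, hM⟩ := exists_matrix_chain hρ (v := v) n p hpC (fun i => by
    obtain ⟨t, ht⟩ := exists_coords_of_mem_affineSpan_pair (hpl i)
    simp [hvdef, ht]
    ring) I hI
  obtain ⟨c, rfl⟩ := exists_eq_smul_one_of_circle_eigen hρ (M := M) (fun x hx => by
    simpa only [hid x hx] using hM x hx)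
  have hc : c = κ := by
    rw [smul_mulVec, one_mulVec] at hMv
    exact smul_left_injective ℝ hv hMv
  simp [hn.neg_one_pow, hc] at hdet
  have : κ ^ 3 ≠ 0 := pow_ne_zero 3 hκ
  exact this (by linarith)
end

section
/- (Butterfly theorem.) Let a and b be two distinct points of the circle C, let ℓ be the line through a and b, and let q = (a + b)/2 be the midpoint of the chord ab. Let x, y, z, t ∈ C, none lying on ℓ, and let p, r ∈ ℓ be points not on C such that p lies on the line xy, q on the line yz, r on the line zt, and q on the line tx. Then dist(p, q) = dist(r, q). -/
open Metric

namespace E2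

/-- The cross product of two vectors of the plane. -/
def cross (v w : E2) : ℝ := v 0 * w 1 - v 1 * w 0

theorem cross_add_left (v₁ v₂ w : E2) : cross (v₁ + v₂) w = cross v₁ w + cross v₂ w := by
  simp only [cross, PiLp.add_apply]; ring

theorem cross_add_right (v w₁ w₂ : E2) : cross v (w₁ + w₂) = cross v w₁ + cross v w₂ := by
  simp only [cross, PiLp.add_apply]; ring

theorem cross_sub_left (v₁ v₂ w : E2) : cross (v₁ - v₂) w = cross v₁ w - cross v₂ w := by
  simp only [cross, PiLp.sub_apply]; ring

theorem cross_sub_right (v w₁ w₂ : E2) : cross v (w₁ - w₂) = cross v w₁ - cross v w₂ := by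
  simp only [cross, PiLp.sub_apply]; ring

theorem cross_smul_left (k : ℝ) (v w : E2) : cross (k • v) w = k * cross v w := by
  simp only [cross, PiLp.smul_apply, smul_eq_mul]; ring

theorem cross_smul_right (k : ℝ) (v w : E2) : cross v (k • w) = k * cross v w := by
  simp only [cross, PiLp.smul_apply, smul_eq_mul]; ring

theorem cross_self (v : E2) : cross v v = 0 := by
  simp only [cross]; ring

theorem cross_swap (v w : E2) : cross w v = -cross v w := by
  simp only [cross]; ring

theorem inner_eq_coord (v w : E2) : inner ℝ v w = v 0 * w 0 + v 1 * w 1 := by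
  simp [PiLp.inner_apply, Fin.sum_univ_two, mul_comm]

theorem cross_mul_inner_sub (u c v w : E2) :
    cross u v * inner ℝ c w - cross u w * inner ℝ c v = -(inner ℝ u c * cross v w) := by
  simp only [cross, inner_eq_coord]; ring

theorem exists_smul_eq_of_cross_eq_zero {u v : E2} (hu : u ≠ 0) (h : cross u v = 0) :
    ∃ k : ℝ, v = k • u := by
  have hn : inner ℝ u u ≠ 0 := inner_self_ne_zero.mpr hu
  refine ⟨inner ℝ u v / inner ℝ u u, ?_⟩
  simp only [inner_eq_coord, cross] at *
  ext i
  fin_cases i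
  · simp only [Fin.zero_eta, PiLp.smul_apply, smul_eq_mul]
    rw [div_mul_eq_mul_div, eq_div_iff hn]
    linear_combination (-u 1) * h
  · simp only [Fin.mk_one, PiLp.smul_apply, smul_eq_mul]
    rw [div_mul_eq_mul_div, eq_div_iff hn]
    linear_combination u 0 * h

/-- If the origin is on the line through two points `y`, `z` of a circle with center `c`, then `z`
is a multiple of `y`, with factor determined by the power `-m` of the origin. -/
theorem exists_smul_of_second_intersection {y z c : E2} {m s : ℝ}
    (hy : y ≠ 0)
    (hyC : inner ℝ y y - 2 * inner ℝ c y = m) (hzC : inner ℝ z z - 2 * inner ℝ c z = m)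
    (h : y + s • (z - y) = 0) :
    ∃ k : ℝ, z = k • y ∧ k * inner ℝ y y = -m := by
  have hs : s ≠ 0 := by
    rintro rfl
    exact hy (by simpa using h)
  have hzk : z = ((s - 1) / s) • y := by
    have h1 : s • z = (s - 1) • y := by
      linear_combination (norm := module) h
    rw [div_eq_inv_mul, mul_smul, ← h1, smul_smul, inv_mul_cancel₀ hs, one_smul]
  refine ⟨(s - 1) / s, hzk, ?_⟩
  have hk : (s - 1) / s - 1 ≠ 0 := by
    have : (s - 1) / s - 1 = -s⁻¹ := by field_simp; ring
    rw [this]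
    exact neg_ne_zero.mpr (inv_ne_zero hs)
  generalize (s - 1) / s = k at hzk hk
  subst hzk
  simp only [inner_smul_left, inner_smul_right, conj_trivial] at hzC
  apply mul_left_cancel₀ hk
  linear_combination hzC - k * hyC

/-- The butterfly theorem with the midpoint of the chord at the origin: `u` is half of the chord,
`c` the center of the circle. -/
theorem butterfly_origin {u c x y z t : E2} {α β s₁ s₂ s₃ s₄ : ℝ}
    (huc : inner ℝ u c = 0)
    (hx : inner ℝ x x - 2 * inner ℝ c x = inner ℝ u u)
    (hy : inner ℝ y y - 2 * inner ℝ c y = inner ℝ u u)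
    (hz : inner ℝ z z - 2 * inner ℝ c z = inner ℝ u u)
    (ht : inner ℝ t t - 2 * inner ℝ c t = inner ℝ u u)
    (hxu : cross u x ≠ 0) (hyu : cross u y ≠ 0) (htu : cross u t ≠ 0)
    (hp : x + s₁ • (y - x) = α • u) (hyz : y + s₂ • (z - y) = 0)
    (hr : z + s₃ • (t - z) = β • u) (htx : t + s₄ • (x - t) = 0) :
    α = -β := by
  have ne_zero : ∀ {v : E2}, cross u v ≠ 0 → v ≠ 0 := by
    rintro v hv rfl
    exact hv (by simp [cross])
  obtain ⟨k, rfl, hk⟩ :=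
    exists_smul_of_second_intersection (ne_zero hyu) hy hz hyz
  obtain ⟨l, rfl, hl⟩ :=
    exists_smul_of_second_intersection (ne_zero htu) ht hx htx
  have hM : inner ℝ t t ≠ 0 := inner_self_ne_zero.mpr (ne_zero htu)
  have hpu := congrArg (cross u) hp
  have hpx := congrArg (fun v => cross v (y - l • t)) hp
  have hrz := congrArg (fun v => cross v (t - k • y)) hr
  simp only [cross_add_left, cross_add_right, cross_sub_left, cross_sub_right,
    cross_smul_left, cross_smul_right, cross_self, cross_swap y t] at hpu hpx hrz hxu
  have hA := cross_mul_inner_sub u c y t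
  rw [huc] at hA
  have hne : cross u y - l * cross u t ≠ 0 := by
    intro h0
    apply hxu
    linear_combination hpu - s₁ * h0
  apply eq_neg_of_add_eq_zero_left
  apply mul_left_cancel₀ (mul_ne_zero hM hne)
  linear_combination -inner ℝ t t * hpx - cross y t * hl - inner ℝ y y * hrz + cross y t * hk
    - β * cross u t * hl + β * cross u y * hk + 2 * β * hA + β * cross u y * ht
    - β * cross u t * hy

end E2

/-- The butterfly theorem: let `q` be the midpoint of a chord `ab` of the circle `C`, and let
`xyzt` be an inscribed quadrilateral whose sides `xy`, `yz`, `zt`, `tx` meet the line `ab`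
in `p`, `q`, `r`, `q` respectively. Then `dist p q = dist r q`. -/
theorem butterfly
    (o : E2) (ρ : ℝ) (hρ : 0 < ρ)
    (a b : E2) (hab : a ≠ b)
    (haC : a ∈ sphere o ρ) (hbC : b ∈ sphere o ρ)
    (q : E2) (hq : q = midpoint ℝ a b)
    (x y z t : E2)
    (hxC : x ∈ sphere o ρ) (hyC : y ∈ sphere o ρ)
    (hzC : z ∈ sphere o ρ) (htC : t ∈ sphere o ρ)
    (hxl : x ∉ affineSpan ℝ ({a, b} : Set E2))
    (hyl : y ∉ affineSpan ℝ ({a, b} : Set E2))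
    (hzl : z ∉ affineSpan ℝ ({a, b} : Set E2))
    (htl : t ∉ affineSpan ℝ ({a, b} : Set E2))
    (p r : E2)
    (hpl : p ∈ affineSpan ℝ ({a, b} : Set E2))
    (hrl : r ∈ affineSpan ℝ ({a, b} : Set E2))
    (hpC : p ∉ sphere o ρ) (hrC : r ∉ sphere o ρ)
    (hpxy : p ∈ affineSpan ℝ ({x, y} : Set E2))
    (hqyz : q ∈ affineSpan ℝ ({y, z} : Set E2))
    (hrzt : r ∈ affineSpan ℝ ({z, t} : Set E2))
    (hqtx : q ∈ affineSpan ℝ ({t, x} : Set E2)) :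
    dist p q = dist r q := by
  have hline : ∀ {v w e : E2}, e ∈ affineSpan ℝ ({v, w} : Set E2) →
      ∃ s : ℝ, (v - q) + s • ((w - q) - (v - q)) = e - q := by
    intro v w e he
    obtain ⟨s, rfl⟩ := mem_affineSpan_pair_iff_exists_lineMap_eq.mp he
    refine ⟨s, ?_⟩
    rw [AffineMap.lineMap_apply_module]
    module
  have haq : a - q = -(b - q) := by
    rw [hq, midpoint_eq_smul_add, invOf_eq_inv]
    module
  have hu : b - q ≠ 0 := by
    intro h
    rw [h, neg_zero] at haq
    exact hab ((sub_eq_zero.mp haq).trans (sub_eq_zero.mp h).symm)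
  have hchord : ∀ {e : E2}, e ∈ affineSpan ℝ ({a, b} : Set E2) →
      ∃ k : ℝ, e - q = k • (b - q) := by
    intro e he
    obtain ⟨s, hs⟩ := hline he
    refine ⟨2 * s - 1, ?_⟩
    rw [← hs, haq]
    module
  have hoff : ∀ {e : E2}, e ∉ affineSpan ℝ ({a, b} : Set E2) → E2.cross (b - q) (e - q) ≠ 0 := by
    intro e he h
    obtain ⟨k, hk⟩ := E2.exists_smul_eq_of_cross_eq_zero hu h
    refine he (mem_affineSpan_pair_iff_exists_lineMap_eq.mpr ⟨(1 + k) / 2, ?_⟩)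
    rw [AffineMap.lineMap_apply_module]
    linear_combination (norm := module) ((1 - k) / 2) • haq - hk
  have hcircle : ∀ {e : E2}, e ∈ sphere o ρ →
      inner ℝ (e - q) (e - q) - 2 * inner ℝ (o - q) (e - q) + inner ℝ (o - q) (o - q) = ρ ^ 2 := by
    intro e he
    rw [mem_sphere, dist_eq_norm, ← sub_sub_sub_cancel_right e o q] at he
    rw [← he, ← real_inner_self_eq_norm_sq, real_inner_sub_sub_self (e - q) (o - q),
      real_inner_comm (e - q) (o - q)]
  have ha := hcircle haC
  have hb := hcircle hbC
  rw [haq, inner_neg_neg, inner_neg_right] at ha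
  have huc : inner ℝ (o - q) (b - q) = 0 := by linarith
  have hpow : ∀ {e : E2}, e ∈ sphere o ρ →
      inner ℝ (e - q) (e - q) - 2 * inner ℝ (o - q) (e - q) = inner ℝ (b - q) (b - q) := by
    intro e he
    linarith [hcircle he]
  obtain ⟨α, hα⟩ := hchord hpl
  obtain ⟨β, hβ⟩ := hchord hrl
  obtain ⟨s₁, hp⟩ := hline hpxy
  obtain ⟨s₂, hyz⟩ := hline hqyz
  obtain ⟨s₃, hr⟩ := hline hrzt
  obtain ⟨s₄, htx⟩ := hline hqtx
  rw [sub_self] at hyz htx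
  have key := E2.butterfly_origin ((real_inner_comm _ _).trans huc) (hpow hxC) (hpow hyC)
    (hpow hzC) (hpow htC) (hoff hxl) (hoff hyl) (hoff htl) (hp.trans hα) hyz
    (hr.trans hβ) htx
  rw [dist_eq_norm, dist_eq_norm, hα, hβ, key, neg_smul, norm_neg]
end
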